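/- Let ν > -1 and define the truncated Appell-Dunkl polynomials A_{n,ν}(x) = γ_{n,ν}·Σ_{k=0}^n x^k/γ_{k,ν}. Then (i) Λ_ν A_{n,ν} = (γ_{n,ν}/γ_{n−1,ν})·A_{n−1,ν} for every n ≥ 1, and (ii) for every x ∈ ℝ and every t with |t| < 1, Σ_{n≥0} A_{n,ν}(x)·t^n/γ_{n,ν} = E_ν(xt)/(1 − t), where E_ν(s) = Σ_{n≥0} s^n/γ_{n,ν}. -/

import Mathlib

open Polynomial

noncomputable def gammaDunkl (ν : ℝ) (n : ℕ) : ℝ :=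
  if Even n then 2 ^ n * (Nat.factorial (n / 2)) * (ascPochhammer ℝ (n / 2)).eval (ν + 1)
  else 2 ^ n * (Nat.factorial (n / 2)) * (ascPochhammer ℝ (n / 2 + 1)).eval (ν + 1)

noncomputable def dunklOp (ν : ℝ) (p : Polynomial ℝ) : Polynomial ℝ :=
  derivative p + C ((2 * ν + 1) / 2) * (p - p.comp (-X)).divX

/-- The Dunkl kernel `E_ν(s) = Σ_{n≥0} s^n / γ_{n,ν}`. -/
noncomputable def dunklKernel (ν t : ℝ) : ℝ := ∑' n : ℕ, t ^ n / gammaDunkl ν n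

/-- The truncated Appell-Dunkl polynomials `A_{n,ν}(x) = γ_{n,ν} Σ_{k=0}^n x^k/γ_{k,ν}`. -/
noncomputable def truncatedAppellDunkl (ν : ℝ) (n : ℕ) : Polynomial ℝ :=
  C (gammaDunkl ν n) * ∑ k ∈ Finset.range (n + 1), C (1 / gammaDunkl ν k) * X ^ k

theorem gammaDunkl_pos {ν : ℝ} (hν : -1 < ν) (n : ℕ) : 0 < gammaDunkl ν n := by
  have h (k : ℕ) : 0 < (ascPochhammer ℝ k).eval (ν + 1) := ascPochhammer_pos k _ (by linarith)
  have h₁ := h (n / 2)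
  have h₂ := h (n / 2 + 1)
  unfold gammaDunkl
  split_ifs <;> positivity

theorem gammaDunkl_succ (ν : ℝ) (n : ℕ) :
    gammaDunkl ν (n + 1)
      = ((n + 1 : ℝ) + (2 * ν + 1) / 2 * (1 - (-1) ^ (n + 1))) * gammaDunkl ν n := by
  rcases Nat.even_or_odd' n with ⟨k, rfl | rfl⟩
  · have h₁ : ¬ Even (2 * k + 1) := by simp
    have h₂ : (2 * k + 1) / 2 = k := by omega
    have h₃ : 2 * k / 2 = k := by omega
    simp only [gammaDunkl, h₁, h₂, h₃, if_false, even_two_mul, if_true, ascPochhammer_succ_eval,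
      pow_succ, pow_mul]
    push_cast
    norm_num
    ring
  · have h₁ : ¬ Even (2 * k + 1) := by simp
    have h₂ : (2 * k + 1) / 2 = k := by omega
    have h₃ : (2 * k + 1 + 1) / 2 = k + 1 := by omega
    have h₄ : Even (2 * k + 1 + 1) := ⟨k + 1, by ring⟩
    simp only [gammaDunkl, h₁, h₂, h₃, h₄, if_false, if_true, Nat.factorial_succ,
      pow_succ, pow_mul]
    push_cast
    norm_num
    ring

theorem nat_mul_gammaDunkl_le_succ {ν : ℝ} (hν : -1 < ν) (n : ℕ) :
    n * gammaDunkl ν n ≤ gammaDunkl ν (n + 1) := by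
  rw [gammaDunkl_succ]
  refine mul_le_mul_of_nonneg_right ?_ (gammaDunkl_pos hν n).le
  rcases neg_one_pow_eq_or ℝ (n + 1) with h | h <;> rw [h] <;> linarith

theorem summable_norm_pow_div_gammaDunkl {ν : ℝ} (hν : -1 < ν) (s : ℝ) :
    Summable fun n : ℕ => ‖s ^ n / gammaDunkl ν n‖ := by
  refine summable_of_ratio_norm_eventually_le (r := 1 / 2) (by norm_num) ?_
  filter_upwards [Filter.eventually_ge_atTop ⌈2 * |s|⌉₊] with n hn
  have hn' : 2 * |s| ≤ n := Nat.ceil_le.mp hn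
  have h₀ := gammaDunkl_pos hν n
  have h₁ := gammaDunkl_pos hν (n + 1)
  have h : 2 * |s| * gammaDunkl ν n ≤ gammaDunkl ν (n + 1) :=
    (mul_le_mul_of_nonneg_right hn' h₀.le).trans (nat_mul_gammaDunkl_le_succ hν n)
  simp only [norm_div, norm_pow, Real.norm_eq_abs, abs_abs, abs_of_pos h₀, abs_of_pos h₁]
  rw [← mul_div_assoc, div_le_div_iff₀ h₁ h₀, pow_succ]
  nlinarith [mul_le_mul_of_nonneg_left h (pow_nonneg (abs_nonneg s) n)]

theorem coeff_dunklOp (ν : ℝ) (p : ℝ[X]) (m : ℕ) :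
    (dunklOp ν p).coeff m
      = ((m + 1 : ℝ) + (2 * ν + 1) / 2 * (1 - (-1) ^ (m + 1))) * p.coeff (m + 1) := by
  have h : (-X : ℝ[X]) = C (-1) * X := by simp
  rw [dunklOp, coeff_add, coeff_derivative, coeff_C_mul, coeff_divX, coeff_sub, h,
    comp_C_mul_X_coeff]
  ring

theorem coeff_truncatedAppellDunkl (ν : ℝ) (n m : ℕ) :
    (truncatedAppellDunkl ν n).coeff m
      = if m ≤ n then gammaDunkl ν n / gammaDunkl ν m else 0 := by
  simp [truncatedAppellDunkl, coeff_X_pow, div_eq_mul_inv]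

theorem eval_truncatedAppellDunkl (ν : ℝ) (n : ℕ) (x : ℝ) :
    (truncatedAppellDunkl ν n).eval x
      = gammaDunkl ν n * ∑ k ∈ Finset.range (n + 1), x ^ k / gammaDunkl ν k := by
  simp [truncatedAppellDunkl, eval_finsetSum, div_eq_inv_mul]

theorem truncatedAppellDunkl_props (ν : ℝ) (hν : -1 < ν) :
    (∀ n : ℕ, 1 ≤ n →
      dunklOp ν (truncatedAppellDunkl ν n)
        = C (gammaDunkl ν n / gammaDunkl ν (n - 1)) * truncatedAppellDunkl ν (n - 1)) ∧
    (∀ x t : ℝ, |t| < 1 →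
      HasSum (fun n : ℕ => (truncatedAppellDunkl ν n).eval x * t ^ n / gammaDunkl ν n)
        (dunklKernel ν (x * t) / (1 - t))) := by
  refine ⟨fun n hn => ?_, fun x t ht => ?_⟩
  · obtain ⟨n, rfl⟩ := Nat.exists_eq_add_of_le' hn
    ext m
    have h₀ := (gammaDunkl_pos hν n).ne'
    have h₁ := (gammaDunkl_pos hν m).ne'
    have h₂ := (gammaDunkl_pos hν (m + 1)).ne'
    rw [coeff_dunklOp, coeff_C_mul, coeff_truncatedAppellDunkl, coeff_truncatedAppellDunkl]
    simp only [Nat.add_sub_cancel, Nat.add_le_add_iff_right]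
    split_ifs
    · rw [div_mul_div_cancel₀ h₀, ← mul_div_assoc, div_eq_div_iff h₂ h₁, gammaDunkl_succ ν m]
      ring
    · simp
  · have h := hasSum_sum_range_mul_of_summable_norm
      (summable_norm_pow_div_gammaDunkl hν (x * t))
      (summable_norm_geometric_of_norm_lt_one (r := t) ht)
    rw [tsum_geometric_of_norm_lt_one ht, ← div_eq_mul_inv] at h
    refine (congrArg (HasSum · _) (funext fun n => ?_)).mpr h
    rw [eval_truncatedAppellDunkl, mul_assoc, mul_div_cancel_left₀ _ (gammaDunkl_pos hν n).ne',
      Finset.sum_mul]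
    refine Finset.sum_congr rfl fun k hk => ?_
    rw [← pow_mul_pow_sub t (Finset.mem_range_succ_iff.mp hk)]
    ring
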